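/- arXiv:0903.2357 — 4 statements merged into one kernel-verified Lean document; each statement's English description precedes it below -/
import Mathlib

section
/- Let g > 0 and α ≠ 0 be real numbers, and let φ : ℝ → ℝ be a twice differentiable function satisfying φ''(t) + 2g²·φ(t)³ = 0 for all t. Then the time-dependent SU(2) gauge field given by Smilga's choice, A_ν^a(t,x) = 0 for ν = 0 and A_k^a(t,x) = δ_k^a · φ(t) for k ∈ {1,2,3} (independent of the spatial variables), satisfies the gauge-fixed SU(2) Yang–Mills field equations with coupling g and gauge parameter α, for every a ∈ {1,2,3} and ν ∈ {0,1,2,3}. -/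
/-- Partial derivative along the `μ`-th coordinate of a function on ℝ⁴. -/
noncomputable def pd (μ : Fin 4) (f : (Fin 4 → ℝ) → ℝ) (x : Fin 4 → ℝ) : ℝ :=
  fderiv ℝ f x (Pi.single μ 1)

/-- Minkowski metric diag(1, -1, -1, -1) (diagonal entries). -/
noncomputable def eta : Fin 4 → ℝ := fun μ => if μ = 0 then 1 else -1

/-- Levi-Civita symbol on three indices (structure constants of SU(2)). -/
noncomputable def eps (a b c : Fin 3) : ℝ :=
  (((b : ℕ) : ℝ) - ((a : ℕ) : ℝ)) * (((c : ℕ) : ℝ) - ((a : ℕ) : ℝ)) *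
    (((c : ℕ) : ℝ) - ((b : ℕ) : ℝ)) / 2

/-- Smilga's choice: `A_0^a = 0`, `A_k^a = δ_k^a φ` for spatial `k`. -/
noncomputable def smilga (φ : (Fin 4 → ℝ) → ℝ) (a : Fin 3) (ν : Fin 4)
    (x : Fin 4 → ℝ) : ℝ :=
  if ν = Fin.succ a then φ x else 0

/-- The left-hand side of the gauge-fixed SU(2) Yang-Mills field equations
with coupling `g` and gauge parameter `α`, for color `a` and spacetime index `ν`:
∂^μ∂_μ A_ν^a − (1 − 1/α) ∂_ν(∂^μ A_μ^a) + g ε_{abc} A^{bμ}(∂_μ A_ν^c − ∂_ν A_μ^c)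
 + g ε_{abc} ∂^μ(A_μ^b A_ν^c) + g² ε_{abc} ε_{cde} A^{bμ} A_μ^d A_ν^e. -/
noncomputable def ymLhs (g α : ℝ) (A : Fin 3 → Fin 4 → (Fin 4 → ℝ) → ℝ)
    (a : Fin 3) (ν : Fin 4) (x : Fin 4 → ℝ) : ℝ :=
  (∑ μ, eta μ * pd μ (pd μ (A a ν)) x)
  - (1 - 1 / α) * pd ν (fun y => ∑ μ, eta μ * pd μ (A a μ) y) x
  + g * ∑ b, ∑ c, eps a b c *
      ∑ μ, eta μ * A b μ x * (pd μ (A c ν) x - pd ν (A c μ) x)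
  + g * ∑ b, ∑ c, eps a b c *
      ∑ μ, eta μ * pd μ (fun y => A b μ y * A c ν y) x
  + g ^ 2 * ∑ b, ∑ c, ∑ d, ∑ e, eps a b c * eps c d e *
      (∑ μ, eta μ * A b μ x * A d μ x) * A e ν x

lemma pd_time (f : ℝ → ℝ) (hf : Differentiable ℝ f) (μ : Fin 4) :
    pd μ (fun y => f (y 0)) = fun x => if μ = 0 then deriv f (x 0) else 0 := by
  funext x
  have h1 : HasFDerivAt (fun y : Fin 4 → ℝ => y 0)
      (ContinuousLinearMap.proj (R := ℝ) (φ := fun _ : Fin 4 => ℝ) 0) x :=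
    (ContinuousLinearMap.proj (R := ℝ) (φ := fun _ : Fin 4 => ℝ) 0).hasFDerivAt
  have h2 := (hf (x 0)).hasDerivAt.comp_hasFDerivAt x h1
  have h3 : fderiv ℝ (fun y : Fin 4 → ℝ => f (y 0)) x = _ := h2.fderiv
  unfold pd
  rw [h3]
  by_cases h : μ = 0
  · subst h; simp
  · have h' : (0 : Fin 4) ≠ μ := fun e => h e.symm
    simp [h, h']

lemma pd_zero_fun (μ : Fin 4) : pd μ (fun _ => (0 : ℝ)) = fun _ => 0 := by
  funext x; simp [pd]

lemma pd_smilga (φ : ℝ → ℝ) (hφ : Differentiable ℝ φ) (a : Fin 3) (μ ν : Fin 4) :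
    pd μ (smilga (fun y => φ (y 0)) a ν) =
      fun x => if ν = Fin.succ a then (if μ = 0 then deriv φ (x 0) else 0) else 0 := by
  by_cases h : ν = Fin.succ a
  · have : smilga (fun y => φ (y 0)) a ν = fun y => φ (y 0) := by
      funext y; simp [smilga, h]
    rw [this, pd_time φ hφ]; simp [h]
  · have : smilga (fun y => φ (y 0)) a ν = fun y => 0 := by
      funext y; simp [smilga, h]
    rw [this, pd_zero_fun]; simp [h]

lemma pd_pd_smilga (φ : ℝ → ℝ) (hφ : Differentiable ℝ φ) (hφ' : Differentiable ℝ (deriv φ))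
    (a : Fin 3) (μ ν : Fin 4) (x : Fin 4 → ℝ) :
    pd μ (pd μ (smilga (fun y => φ (y 0)) a ν)) x =
      if ν = Fin.succ a then (if μ = 0 then deriv (deriv φ) (x 0) else 0) else 0 := by
  rw [pd_smilga φ hφ]
  by_cases h : ν = Fin.succ a
  · by_cases h' : μ = 0
    · simp only [h, h', if_true, pd_time _ hφ']
    · simp only [h, h', if_true, if_false, pd_zero_fun]
  · simp only [h, if_false, pd_zero_fun]

lemma pd_div (φ : ℝ → ℝ) (hφ : Differentiable ℝ φ) (a : Fin 3) :
    (fun y => ∑ μ, eta μ * pd μ (smilga (fun y => φ (y 0)) a μ) y) = fun _ => 0 := by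
  funext y
  apply Finset.sum_eq_zero
  intro μ _
  rw [pd_smilga φ hφ]
  by_cases h' : μ = 0
  · subst h'; simp [(Fin.succ_ne_zero a).symm]
  · simp [h']

lemma pd_prod (φ : ℝ → ℝ) (hφ : Differentiable ℝ φ) (b c : Fin 3) (μ ν : Fin 4)
    (x : Fin 4 → ℝ) :
    pd μ (fun y => smilga (fun y => φ (y 0)) b μ y * smilga (fun y => φ (y 0)) c ν y) x = 0 := by
  by_cases h : μ = Fin.succ b ∧ ν = Fin.succ c
  · have : (fun y => smilga (fun y => φ (y 0)) b μ y * smilga (fun y => φ (y 0)) c ν y)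
        = fun y => (fun t => φ t * φ t) (y 0) := by
      funext y; simp [smilga, h.1, h.2]
    rw [this, pd_time (fun t => φ t * φ t) (hφ.mul hφ)]
    simp [h.1]
  · have : (fun y => smilga (fun y => φ (y 0)) b μ y * smilga (fun y => φ (y 0)) c ν y)
        = fun y => 0 := by
      funext y
      simp only [smilga]
      by_cases h1 : μ = Fin.succ b
      · have h2 : ν ≠ Fin.succ c := fun e => h ⟨h1, e⟩
        simp [h2]
      · simp [h1]
    rw [this, pd_zero_fun]

/-- if `φ : ℝ → ℝ` is twice differentiable and satisfies
`φ'' + 2 g² φ³ = 0`, then the time-dependent Smilga configuration built from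
`x ↦ φ(x⁰)` solves the gauge-fixed SU(2) Yang-Mills equations. -/
theorem smilga_time_dependent_solves_yangMills
    (g α : ℝ) (hg : 0 < g) (hα : α ≠ 0)
    (φ : ℝ → ℝ) (hφ : Differentiable ℝ φ) (hφ' : Differentiable ℝ (deriv φ))
    (hode : ∀ t : ℝ, deriv (deriv φ) t + 2 * g ^ 2 * (φ t) ^ 3 = 0) :
    ∀ (a : Fin 3) (ν : Fin 4) (x : Fin 4 → ℝ),
      ymLhs g α (smilga (fun y => φ (y 0))) a ν x = 0 := by
  intro a ν x
  have ho := hode (x 0)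
  unfold ymLhs
  rw [pd_div φ hφ]
  simp only [pd_pd_smilga φ hφ hφ']
  simp only [pd_prod φ hφ, pd_zero_fun, pd_smilga φ hφ]
  have e0 : eta 0 = 1 := by simp [eta]
  have e1 : eta 1 = -1 := by simp [eta]
  have e2 : eta 2 = -1 := by simp [eta]
  have e3 : eta 3 = -1 := by simp [eta]
  have s0 : Fin.succ (0 : Fin 3) = 1 := rfl
  have s1 : Fin.succ (1 : Fin 3) = 2 := rfl
  have s2 : Fin.succ (2 : Fin 3) = 3 := rfl
  simp only [smilga]
  fin_cases a <;> fin_cases ν <;>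
    simp [Fin.sum_univ_three, Fin.sum_univ_four, e0, e1, e2, e3, eps, s0, s1, s2] <;>
    linarith
end

section
/- Let λ > 0, μ ≠ 0 and c be real numbers, let f : ℝ → ℝ be twice differentiable with f''(u) + 2·f(u)³ = 0 for all u, and let p ∈ ℝ⁴ satisfy η^{μν} p_μ p_ν = μ²·√(λ/2). Then the function φ : ℝ⁴ → ℝ defined by φ(x) = μ·(2/λ)^{1/4}·f(p_μ x^μ + c) satisfies the massless quartic scalar field equation η^{μν} ∂_μ ∂_ν φ + λ·φ³ = 0 on all of ℝ⁴. -/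
theorem pd_wave_aux (A c : ℝ) (g : ℝ → ℝ) (hg : Differentiable ℝ g) (p : Fin 4 → ℝ) (ν : Fin 4) :
    pd ν (fun x => A * g ((∑ κ, p κ * x κ) + c)) =
      fun x => (A * p ν) * deriv g ((∑ κ, p κ * x κ) + c) := by
  funext x
  have hL : HasFDerivAt (fun x : Fin 4 → ℝ => (∑ κ, p κ * x κ) + c)
      (∑ κ, p κ • (ContinuousLinearMap.proj κ : (Fin 4 → ℝ) →L[ℝ] ℝ)) x := by
    refine HasFDerivAt.add_const c ?_
    refine HasFDerivAt.fun_sum fun κ _ => ?_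
    exact (hasFDerivAt_apply κ x).const_mul (p κ)
  have h := (((hg _).hasDerivAt.comp_hasFDerivAt x hL).const_mul A)
  have h2 : HasFDerivAt (fun x : Fin 4 → ℝ => A * g ((∑ κ, p κ * x κ) + c)) _ x := h
  unfold pd
  rw [h2.fderiv]
  simp [Pi.single_apply]
  ring

/-- the snoidal travelling wave
`φ(x) = μ (2/λ)^{1/4} f(p·x + c)`, with `f'' + 2f³ = 0` and the dispersion
relation `η^{μν} p_μ p_ν = μ² √(λ/2)`, solves the massless quartic scalar field
equation `η^{μν} ∂_μ ∂_ν φ + λ φ³ = 0` on all of ℝ⁴. -/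
theorem snoidal_wave_solves_quartic_scalar
    (lam μ c : ℝ) (hlam : 0 < lam) (hμ : μ ≠ 0)
    (f : ℝ → ℝ) (hf : Differentiable ℝ f) (hf' : Differentiable ℝ (deriv f))
    (hode : ∀ u : ℝ, deriv (deriv f) u + 2 * (f u) ^ 3 = 0)
    (p : Fin 4 → ℝ)
    (hdisp : ∑ ν, eta ν * p ν * p ν = μ ^ 2 * Real.sqrt (lam / 2))
    (φ : (Fin 4 → ℝ) → ℝ)
    (hφ : ∀ x : Fin 4 → ℝ,
      φ x = μ * (2 / lam) ^ ((1 : ℝ) / 4) * f ((∑ ν, p ν * x ν) + c)) :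
    ∀ x : Fin 4 → ℝ, (∑ ν, eta ν * pd ν (pd ν φ) x) + lam * (φ x) ^ 3 = 0 := by
  intro x
  obtain rfl : φ = fun x => μ * (2 / lam) ^ ((1 : ℝ) / 4) * f ((∑ ν, p ν * x ν) + c) := funext hφ
  simp only [pd_wave_aux _ _ f hf, pd_wave_aux _ _ _ hf']
  set B := (2 / lam) ^ ((1 : ℝ) / 4) with hB
  set u := (∑ ν, p ν * x ν) + c
  have hB2 : B ^ 2 = Real.sqrt (2 / lam) := by
    rw [hB, ← Real.rpow_natCast, ← Real.rpow_mul (by positivity), Real.sqrt_eq_rpow]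
    norm_num
  have hs : lam * Real.sqrt (2 / lam) = 2 * Real.sqrt (lam / 2) := by
    have h1 : Real.sqrt (2 / lam) = (Real.sqrt (lam / 2))⁻¹ := by
      rw [← Real.sqrt_inv, inv_div]
    have h2 : Real.sqrt (lam / 2) ^ 2 = lam / 2 := Real.sq_sqrt (by positivity)
    have h3 : Real.sqrt (lam / 2) ≠ 0 := by positivity
    rw [h1]
    field_simp
    linarith
  have hsum : ∑ ν, eta ν * (μ * B * p ν * p ν * deriv (deriv f) u)
      = (∑ ν, eta ν * p ν * p ν) * (μ * B * deriv (deriv f) u) := by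
    rw [Finset.sum_mul]
    exact Finset.sum_congr rfl fun ν _ => by ring
  rw [hsum, hdisp]
  have ho : deriv (deriv f) u = - (2 * f u ^ 3) := by linarith [hode u]
  rw [ho]
  have hB3 : lam * B ^ 2 = 2 * Real.sqrt (lam / 2) := by rw [hB2, hs]
  linear_combination (μ ^ 3 * B * f u ^ 3) * hB3
end

section
/- Let φ be a real number and let A_ν^a be the SU(2) field configuration of Smilga's choice: A_0^a = 0 and A_k^a = δ_k^a·φ. Then the quartic term of the Yang–Mills field equations evaluates, for each a ∈ {1,2,3}, to: Σ_{b,c,d,e} ε_{abc} ε_{cde} A^{bμ} A_μ^d A_ν^e = 2·φ³·δ_{aν} when ν ∈ {1,2,3} (identifying the color index with the spatial index), and = 0 when ν = 0, where A^{bμ} A_μ^d = η^{μρ} A_ρ^b A_μ^d with η = diag(1,−1,−1,−1). Hence on Smilga's choice the cubic nonlinearity of the Yang–Mills equations reduces exactly to the scalar nonlinearity 2g²φ³ of the quartic scalar field equation with λ = 2g². -/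
/-- Smilga's choice with constant value `φ`: `A_0^a = 0`, `A_k^a = δ_k^a φ`. -/
noncomputable def smilgaC (φ : ℝ) (a : Fin 3) (ν : Fin 4) : ℝ :=
  if ν = Fin.succ a then φ else 0

/-- on Smilga's choice the quartic term of the Yang-Mills
field equations `Σ ε_{abc} ε_{cde} A^{bμ} A_μ^d A_ν^e` equals `2 φ³ δ_{aν}`
for spatial `ν` (identifying the color and spatial indices) and vanishes for
`ν = 0`: the Yang-Mills cubic nonlinearity reduces to the scalar nonlinearity
`2 g² φ³` with `λ = 2g²`. -/
theorem smilga_quartic_term (φ : ℝ) :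
    ∀ a : Fin 3,
      (∀ k : Fin 3,
        (∑ b, ∑ c, ∑ d, ∑ e, eps a b c * eps c d e *
            (∑ μ, eta μ * smilgaC φ b μ * smilgaC φ d μ) * smilgaC φ e (Fin.succ k))
          = 2 * φ ^ 3 * (if a = k then 1 else 0))
      ∧ (∑ b, ∑ c, ∑ d, ∑ e, eps a b c * eps c d e *
            (∑ μ, eta μ * smilgaC φ b μ * smilgaC φ d μ) * smilgaC φ e 0)
          = 0 := by
  have hmu : ∀ b d : Fin 3, (∑ μ, eta μ * smilgaC φ b μ * smilgaC φ d μ)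
      = if b = d then -φ ^ 2 else 0 := by
    intro b d
    rw [Fin.sum_univ_succ]
    simp only [eta, smilgaC, Fin.succ_inj, Fin.succ_ne_zero, (Fin.succ_ne_zero _).symm, if_false]
    by_cases h : b = d
    · subst h
      simp [pow_two]
    · simp [h, Ne.symm h]
  intro a
  refine ⟨fun k => ?_, ?_⟩
  · simp only [hmu]
    simp only [smilgaC, Fin.succ_inj, mul_ite, ite_mul, mul_zero, zero_mul,
      Finset.sum_ite_eq, Finset.mem_univ, if_true]
    fin_cases a <;> fin_cases k <;> simp [Fin.sum_univ_three, eps] <;> ring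
  · simp [smilgaC, (Fin.succ_ne_zero _).symm]
end

section
/- Let g be a real number, let φ : ℝ⁴ → ℝ be differentiable, and let A_ν^a be the field configuration of Smilga's choice built from φ. Then the gluonic Lagrangian density reduces pointwise to three copies of a quartic scalar field Lagrangian density with coupling λ = 2g²: (1/2)·Σ_{a=1}^{3} ∂_μ A_ν^a ∂^μ A^{aν} − (g²/4)·[(A_μ^a A^{aμ})² − (A_μ^a A^{aν})(A^{bμ} A_ν^b)] = −3·[(1/2)·∂_μ φ ∂^μ φ + (g²/2)·φ⁴], where spacetime indices are raised with η = diag(1,−1,−1,−1) and repeated indices are summed. -/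
/-- on Smilga's choice the gluonic Lagrangian density
`(1/2) Σ_a ∂_μ A_ν^a ∂^μ A^{aν} − (g²/4)[(A_μ^a A^{aμ})² − (A_μ^a A^{aν})(A^{bμ} A_ν^b)]`
reduces pointwise to three copies of the quartic scalar Lagrangian density with
coupling `λ = 2g²`, namely `−3[(1/2) ∂_μ φ ∂^μ φ + (g²/2) φ⁴]`. -/
theorem smilga_lagrangian_density (g : ℝ) (φ : (Fin 4 → ℝ) → ℝ)
    (hφ : Differentiable ℝ φ) :
    ∀ x : Fin 4 → ℝ,
      (1 / 2) * (∑ a, ∑ μ, ∑ ν, eta μ * eta ν *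
          (pd μ (smilga φ a ν) x * pd μ (smilga φ a ν) x))
        - (g ^ 2 / 4) *
          ((∑ μ, ∑ a, eta μ * smilga φ a μ x * smilga φ a μ x) ^ 2
            - ∑ μ, ∑ ν,
                (∑ a, smilga φ a μ x * (eta ν * smilga φ a ν x)) *
                  (∑ b, (eta μ * smilga φ b μ x) * smilga φ b ν x))
      = -3 * ((1 / 2) * (∑ μ, eta μ * (pd μ φ x * pd μ φ x))
                + (g ^ 2 / 2) * (φ x) ^ 4) := by
  have h : ∀ (a : Fin 3) (μ ν : Fin 4) (x : Fin 4 → ℝ),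
      pd μ (smilga φ a ν) x = if ν = Fin.succ a then pd μ φ x else 0 := by
    intro a μ ν x
    by_cases hν : ν = Fin.succ a
    · have : smilga φ a ν = φ := by
        funext y
        simp [smilga, hν]
      rw [this, if_pos hν]
    · have : smilga φ a ν = fun _ => 0 := by
        funext y
        simp [smilga, hν]
      rw [this, if_neg hν]
      simp [pd]
  intro x
  simp only [h]
  simp [smilga, eta, Fin.sum_univ_succ]
  ring
end
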